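/- Let n ≥ 1, c ≥ 1, and let (A₁, A₂; C₁, …, Cₙ; e; f₁, …, f_{n−1}), with A₁, A₂, C₁, …, Cₙ ∈ End(ℂᶜ), e ∈ Hom(ℂᶜ, ℂ) and f₁, …, f_{n−1} ∈ Hom(ℂ, ℂᶜ), satisfy conditions (Q1), (Q2) and (Q3). Then condition (P3) holds: for all ([λ₁, λ₂], (μ₁, μ₂)) ∈ ℙ¹ × ℂ² with λ₁ⁿμ₁ + λ₂ⁿμ₂ = 0, there is no nonzero v ∈ ℂᶜ with C₁A₂v = −μ₁v, CₙA₁v = (−1)ⁿμ₂v, e(v) = 0 and (λ₂A₁ + λ₁A₂)v = 0. -/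

import Mathlib

open Matrix BigOperators

noncomputable section

/-- The space of `c × c` complex matrices, regarded as endomorphisms of `ℂ^c`. -/
abbrev Mat (c : ℕ) : Type := Matrix (Fin c) (Fin c) ℂ

/-- `cos (π x / (c+1))` as a complex number. -/
def cmC (c : ℕ) (x : ℝ) : ℂ := Complex.ofReal (Real.cos (Real.pi * x / (c + 1)))

/-- `sin (π x / (c+1))` as a complex number. -/
def smC (c : ℕ) (x : ℝ) : ℂ := Complex.ofReal (Real.sin (Real.pi * x / (c + 1)))

/-- Condition (P1): for `n = 1`, `A₁C₁A₂ = A₂C₁A₁`; for `n > 1`,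
`A₁C_q = A₂C_{q+1}` and `C_qA₁ = C_{q+1}A₂` for `q = 1, …, n-1`. -/
def CondP1 (n c : ℕ) (A1 A2 : Mat c) (C : ℕ → Mat c) : Prop :=
  if n = 1 then A1 * C 1 * A2 = A2 * C 1 * A1
  else ∀ q : ℕ, 1 ≤ q → q ≤ n - 1 →
    A1 * C q = A2 * C (q + 1) ∧ C q * A1 = C (q + 1) * A2

/-- Condition (P2): the pencil `A₁ + λ A₂` is regular. -/
def CondP2 (c : ℕ) (A1 A2 : Mat c) : Prop :=
  ∃ ν1 ν2 : ℂ, (ν1 • A1 + ν2 • A2).det ≠ 0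

/-- Condition (P3). -/
def CondP3 (n c : ℕ) (A1 A2 : Mat c) (C : ℕ → Mat c) (e : Fin c → ℂ) : Prop :=
  ∀ l1 l2 m1 m2 : ℂ, (l1, l2) ≠ (0, 0) → l1 ^ n * m1 + l2 ^ n * m2 = 0 →
    ¬ ∃ v : Fin c → ℂ, v ≠ 0 ∧
      (C 1 * A2).mulVec v = (-m1) • v ∧
      (C n * A1).mulVec v = ((-1 : ℂ) ^ n * m2) • v ∧
      e ⬝ᵥ v = 0 ∧
      (l2 • A1 + l1 • A2).mulVec v = 0

/-- Condition (T1): `[b₁, b₂] = 0`. -/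
def CondT1 (c : ℕ) (b1 b2 : Mat c) : Prop := b1 * b2 = b2 * b1

/-- Condition (T2): co-stability of the ADHM datum `(b₁, b₂, e)`. -/
def CondT2 (c : ℕ) (b1 b2 : Mat c) (e : Fin c → ℂ) : Prop :=
  ∀ z w : ℂ, ¬ ∃ v : Fin c → ℂ, v ≠ 0 ∧
    b1.mulVec v = z • v ∧ b2.mulVec v = w • v ∧ e ⬝ᵥ v = 0

/-- `A_{1m} = c_m A₁ - s_m A₂`. -/
def Amat1 (c : ℕ) (m : ℝ) (A1 A2 : Mat c) : Mat c := cmC c m • A1 - smC c m • A2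

/-- `A_{2m} = s_m A₁ + c_m A₂`. -/
def Amat2 (c : ℕ) (m : ℝ) (A1 A2 : Mat c) : Mat c := smC c m • A1 + cmC c m • A2

/-- `B_m = A_{2m}⁻¹ A_{1m}`. -/
def Bmat (c : ℕ) (m : ℝ) (A1 A2 : Mat c) : Mat c :=
  (Amat2 c m A1 A2)⁻¹ * Amat1 c m A1 A2

/-- `E_m = (∑_{q=1}^{n} binom(n-1, q-1) c_m^{n-q} s_m^{q-1} C_q) A_{2m}`. -/
def Emat (n c : ℕ) (m : ℝ) (A1 A2 : Mat c) (C : ℕ → Mat c) : Mat c :=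
  (∑ q ∈ Finset.Icc 1 n,
    (((n - 1).choose (q - 1) : ℂ) * cmC c m ^ (n - q) * smC c m ^ (q - 1)) • C q) *
    Amat2 c m A1 A2

/-- A sub-representation `(S₀, S₁)`: `A₁(S₀) ⊆ S₁`, `A₂(S₀) ⊆ S₁`,
and `C_q(S₁) ⊆ S₀` for `q = 1, …, n`. -/
def SubRep (n c : ℕ) (A1 A2 : Mat c) (C : ℕ → Mat c)
    (S0 S1 : Submodule ℂ (Fin c → ℂ)) : Prop :=
  (∀ v ∈ S0, A1.mulVec v ∈ S1 ∧ A2.mulVec v ∈ S1) ∧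
  (∀ v ∈ S1, ∀ q : ℕ, 1 ≤ q → q ≤ n → (C q).mulVec v ∈ S0)

/-- Condition (Q1): for `n = 1`, `A₁C₁A₂ = A₂C₁A₁`; for `n ≥ 2`,
`A₁C_q = A₂C_{q+1}` and `C_qA₁ + f_q∘e = C_{q+1}A₂` for `q = 1, …, n-1`. -/
def CondQ1 (n c : ℕ) (A1 A2 : Mat c) (C : ℕ → Mat c) (e : Fin c → ℂ)
    (f : ℕ → Fin c → ℂ) : Prop :=
  if n = 1 then A1 * C 1 * A2 = A2 * C 1 * A1
  else ∀ q : ℕ, 1 ≤ q → q ≤ n - 1 →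
    A1 * C q = A2 * C (q + 1) ∧ C q * A1 + vecMulVec (f q) e = C (q + 1) * A2

/-- Condition (Q2). -/
def CondQ2 (n c : ℕ) (A1 A2 : Mat c) (C : ℕ → Mat c) (e : Fin c → ℂ) : Prop :=
  ∀ S0 S1 : Submodule ℂ (Fin c → ℂ), SubRep n c A1 A2 C S0 S1 →
    (∀ v ∈ S0, e ⬝ᵥ v = 0) →
    Module.finrank ℂ S0 ≤ Module.finrank ℂ S1 ∧
    (Module.finrank ℂ S0 = Module.finrank ℂ S1 → S0 = ⊥ ∧ S1 = ⊥)

/-- Condition (Q3) (with the framing maps `f_i`): for every sub-representation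
containing all the `Im f_i`, `dim S₀ ≤ dim S₁`; for `n = 1` there are no `f`'s
and the condition applies to every sub-representation. -/
def CondQ3 (n c : ℕ) (A1 A2 : Mat c) (C : ℕ → Mat c)
    (f : ℕ → Fin c → ℂ) : Prop :=
  ∀ S0 S1 : Submodule ℂ (Fin c → ℂ), SubRep n c A1 A2 C S0 S1 →
    (∀ i : ℕ, 1 ≤ i → i ≤ n - 1 → f i ∈ S0) →
    Module.finrank ℂ S0 ≤ Module.finrank ℂ S1

/-- Two vectors with a nontrivial linear relation are multiples of a common vector. -/
lemma exists_common_multiple {K V : Type*} [Field K] [AddCommGroup V] [Module K V]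
    {a b : K} (hab : (a, b) ≠ (0, 0)) {x y : V} (h : b • x + a • y = 0) :
    ∃ w : V, x = a • w ∧ y = -(b • w) := by
  by_cases hb : b = 0
  · subst hb
    have ha : a ≠ 0 := fun ha => hab (by rw [ha])
    have hy : y = 0 := by simpa [ha] using h
    exact ⟨a⁻¹ • x, by simp [smul_smul, ha], by simp [hy]⟩
  · have hx : b • x = -(a • y) := eq_neg_of_add_eq_zero_left h
    refine ⟨-(b⁻¹ • y), ?_, by simp [smul_smul, hb]⟩
    calc x = b⁻¹ • (b • x) := by simp [smul_smul, hb]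
      _ = a • -(b⁻¹ • y) := by rw [hx, smul_neg, smul_neg, smul_comm]

/-- A finite sequence of vectors satisfying `a u_q = -b u_{q+1}` lies in a subspace containing
`b u_1` and `a u_n`. -/
lemma mem_of_geometric_relation {K V : Type*} [Field K] [AddCommGroup V] [Module K V]
    {a b : K} (hab : (a, b) ≠ (0, 0)) {n : ℕ} {u : ℕ → V} (S : Submodule K V)
    (hu : ∀ q, 1 ≤ q → q ≤ n - 1 → a • u q = -(b • u (q + 1)))
    (h_first : b • u 1 ∈ S) (h_last : a • u n ∈ S) (q : ℕ) (hq : 1 ≤ q) (hqn : q ≤ n) :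
    u q ∈ S := by
  by_cases hb : b = 0
  · subst hb
    have ha : a ≠ 0 := fun ha => hab (by rw [ha])
    rcases hqn.eq_or_lt with rfl | hlt
    · exact (S.smul_mem_iff ha).1 h_last
    · have h := hu q hq (by omega)
      have h0 : u q = 0 := by simpa [ha] using h
      rw [h0]
      exact S.zero_mem
  · induction q, hq using Nat.le_induction with
    | base => exact (S.smul_mem_iff hb).1 h_first
    | succ k hk ih =>
      have h := hu k hk (by omega)
      rw [← S.smul_mem_iff hb, ← S.neg_mem_iff, ← h]
      exact S.smul_mem _ (ih (by omega))

/-- conditions (Q1), (Q2), (Q3) imply condition (P3). -/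
theorem stmt_14 (n c : ℕ) (hn : 1 ≤ n) (hc : 1 ≤ c) (A1 A2 : Mat c)
    (C : ℕ → Mat c) (e : Fin c → ℂ) (f : ℕ → Fin c → ℂ)
    (hQ1 : CondQ1 n c A1 A2 C e f) (hQ2 : CondQ2 n c A1 A2 C e)
    (hQ3 : CondQ3 n c A1 A2 C f) :
    CondP3 n c A1 A2 C e := by
  rintro l1 l2 m1 m2 hl - ⟨v, hv, h1, h2, hev, hpencil⟩
  rw [add_mulVec, smul_mulVec, smul_mulVec] at hpencil
  obtain ⟨w, hA1, hA2⟩ := exists_common_multiple hl hpencil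
  rw [← mulVec_mulVec, hA2, mulVec_neg, mulVec_smul, neg_smul, neg_inj] at h1
  rw [← mulVec_mulVec, hA1, mulVec_smul] at h2
  have hrel : ∀ q, 1 ≤ q → q ≤ n - 1 → l1 • C q *ᵥ w = -(l2 • C (q + 1) *ᵥ w) := by
    intro q hq hqn
    rw [CondQ1, if_neg (by omega)] at hQ1
    have h := congrArg (· *ᵥ v) (hQ1 q hq hqn).2
    simpa [add_mulVec, ← mulVec_mulVec, vecMulVec_mulVec, hev, hA1, hA2, mulVec_smul,
      mulVec_neg] using h
  have hv_mem := Submodule.mem_span_singleton_self (R := ℂ) v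
  have hw_mem := Submodule.mem_span_singleton_self (R := ℂ) w
  have hsub : SubRep n c A1 A2 C (ℂ ∙ v) (ℂ ∙ w) := by
    constructor
    · intro x hx
      obtain ⟨t, rfl⟩ := Submodule.mem_span_singleton.1 hx
      rw [mulVec_smul, mulVec_smul, hA1, hA2]
      exact ⟨Submodule.smul_mem _ _ (Submodule.smul_mem _ _ hw_mem),
        Submodule.smul_mem _ _ (Submodule.neg_mem _ (Submodule.smul_mem _ _ hw_mem))⟩
    · intro x hx q hq hqn
      obtain ⟨t, rfl⟩ := Submodule.mem_span_singleton.1 hx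
      rw [mulVec_smul]
      refine Submodule.smul_mem _ _
        (mem_of_geometric_relation (u := fun q => C q *ᵥ w) hl _ hrel ?_ ?_ q hq hqn)
      · exact h1 ▸ Submodule.smul_mem _ _ hv_mem
      · exact h2 ▸ Submodule.smul_mem _ _ hv_mem
  have hker : ∀ x ∈ (ℂ ∙ v), e ⬝ᵥ x = 0 := by
    intro x hx
    obtain ⟨t, rfl⟩ := Submodule.mem_span_singleton.1 hx
    rw [dotProduct_smul, hev, smul_zero]
  obtain ⟨hle, heq⟩ := hQ2 _ _ hsub hker
  have hge : Module.finrank ℂ (ℂ ∙ w) ≤ Module.finrank ℂ (ℂ ∙ v) := by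
    rw [finrank_span_singleton hv]
    simpa using finrank_span_le_card (R := ℂ) ({w} : Set (Fin c → ℂ))
  exact hv (Submodule.span_singleton_eq_bot.1 (heq (hle.antisymm hge)).1)
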